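/- arXiv:math/0701694 — 2 statements merged into one kernel-verified Lean document; each statement's English description precedes it below -/
import Mathlib

section
/- Let 0 < q < 1. There exists a constant K ≥ 1, depending only on q and ℓ, such that for every vector of nonnegative integers λ = (λ₁ ≥ … ≥ λ_{ℓ+1} ≥ 0), the quantity d_λ = ∑_r q^{2ψ(r)}, the sum ranging over the finitely many GT tableaux r with top row λ, satisfies q^{2ψ_min(λ)} ≤ d_λ ≤ K · q^{2ψ_min(λ)}, where ψ_min(λ) = −(ℓ/2)·∑_{j=1}^{ℓ+1} λ_j + ∑_{k=2}^{ℓ+1} (k−1)·λ_k. -/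
def GTInRange (ℓ i j : ℕ) : Prop :=
  1 ≤ i ∧ i ≤ ℓ + 1 ∧ 1 ≤ j ∧ j ≤ ℓ + 2 - i

def IsGT (ℓ : ℕ) (r : ℕ → ℕ → ℕ) : Prop :=
  (∀ i j, ¬ GTInRange ℓ i j → r i j = 0) ∧
  (∀ i j, GTInRange ℓ i j → GTInRange ℓ (i + 1) j → r (i + 1) j ≤ r i j) ∧
  (∀ i j, GTInRange ℓ (i + 1) j → GTInRange ℓ i (j + 1) → r i (j + 1) ≤ r (i + 1) j)

/-- `ψ(r) = -(ℓ/2) ∑_{j=1}^{ℓ+1} r_{1j} + ∑_{i=2}^{ℓ+1} ∑_{j=1}^{ℓ+2-i} r_{ij}`. -/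
noncomputable def psiGT (ℓ : ℕ) (r : ℕ → ℕ → ℕ) : ℝ :=
  -(ℓ : ℝ) / 2 * (∑ j ∈ Finset.Icc 1 (ℓ + 1), (r 1 j : ℝ)) +
    ∑ i ∈ Finset.Icc 2 (ℓ + 1), ∑ j ∈ Finset.Icc 1 (ℓ + 2 - i), (r i j : ℝ)

/-- `ψ_min(λ) = -(ℓ/2) ∑_{j=1}^{ℓ+1} λ_j + ∑_{k=2}^{ℓ+1} (k-1) λ_k`. -/
noncomputable def psiMin (ℓ : ℕ) (lam : ℕ → ℕ) : ℝ :=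
  -(ℓ : ℝ) / 2 * (∑ j ∈ Finset.Icc 1 (ℓ + 1), (lam j : ℝ)) +
    ∑ k ∈ Finset.Icc 2 (ℓ + 1), ((k : ℝ) - 1) * (lam k : ℝ)

/-- The set of GT tableaux with top row `λ`. -/
def GTwith (ℓ : ℕ) (lam : ℕ → ℕ) : Set (ℕ → ℕ → ℕ) :=
  {r | IsGT ℓ r ∧ ∀ j, 1 ≤ j → j ≤ ℓ + 1 → r 1 j = lam j}

/-- `d_λ = ∑_{r : top row λ} q^{2ψ(r)}`. -/
noncomputable def dLam (ℓ : ℕ) (q : ℝ) (lam : ℕ → ℕ) : ℝ :=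
  ∑ᶠ r ∈ GTwith ℓ lam, q ^ (2 * psiGT ℓ r)

/-- Index set of the entries of a GT tableau below its top row. -/
def lowerIndices (ℓ : ℕ) : Finset (Σ _ : ℕ, ℕ) :=
  (Finset.Icc 2 (ℓ + 1)).sigma fun i => Finset.Icc 1 (ℓ + 2 - i)

/-- The excess of the entries of `r` below the top row over the minimal tableau
with top row `lam`. -/
def gtExcess (ℓ : ℕ) (lam : ℕ → ℕ) (r : ℕ → ℕ → ℕ) : lowerIndices ℓ → ℕ :=
  fun x => r x.1.1 x.1.2 - lam (x.1.1 + x.1.2 - 1)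

open Classical in
/-- The tableau with entries `lam (i + j - 1)`. -/
noncomputable def minGT (ℓ : ℕ) (lam : ℕ → ℕ) : ℕ → ℕ → ℕ :=
  fun i j => if GTInRange ℓ i j then lam (i + j - 1) else 0

lemma sum_lowerIndices (ℓ : ℕ) (f : ℕ → ℝ) :
    ∑ i ∈ Finset.Icc 2 (ℓ + 1), ∑ j ∈ Finset.Icc 1 (ℓ + 2 - i), f (i + j - 1) =
      ∑ k ∈ Finset.Icc 2 (ℓ + 1), ((k : ℝ) - 1) * f k := by
  have h1 : ∀ i ∈ Finset.Icc 2 (ℓ + 1),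
      ∑ j ∈ Finset.Icc 1 (ℓ + 2 - i), f (i + j - 1) = ∑ k ∈ Finset.Icc i (ℓ + 1), f k := by
    intro i hi
    rw [Finset.mem_Icc] at hi
    refine Finset.sum_bij' (fun j _ => i + j - 1) (fun k _ => k + 1 - i) ?_ ?_ ?_ ?_ ?_
    all_goals intro a ha
    all_goals simp only [Finset.mem_Icc] at *
    all_goals omega
  rw [Finset.sum_congr rfl h1, Finset.sum_comm' (t' := Finset.Icc 2 (ℓ + 1))
    (s' := fun k => Finset.Icc 2 k) (by intro x y; simp only [Finset.mem_Icc]; omega)]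
  refine Finset.sum_congr rfl fun k hk => ?_
  rw [Finset.mem_Icc] at hk
  rw [Finset.sum_const, Nat.card_Icc, nsmul_eq_mul, show k + 1 - 2 = k - 1 by omega,
    Nat.cast_sub (by omega), Nat.cast_one]

lemma le_entry_of_mem_GTwith {ℓ : ℕ} {lam : ℕ → ℕ} {r : ℕ → ℕ → ℕ} (hr : r ∈ GTwith ℓ lam)
    {i j : ℕ} (h : GTInRange ℓ i j) : lam (i + j - 1) ≤ r i j := by
  obtain ⟨⟨-, -, h3⟩, h4⟩ := hr
  obtain ⟨hi, h⟩ := h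
  induction i, hi using Nat.le_induction generalizing j with
  | base => rw [h4 j (by omega) (by omega), Nat.add_sub_cancel_left]
  | succ i hi ih =>
    have := ih (j := j + 1) (by omega)
    have h5 := h3 i j (by unfold GTInRange; omega) (by unfold GTInRange; omega)
    rw [show i + 1 + j - 1 = i + (j + 1) - 1 by omega]
    omega

lemma lam_le_of_le {ℓ : ℕ} {lam : ℕ → ℕ} (hlam : ∀ j, 1 ≤ j → j ≤ ℓ → lam (j + 1) ≤ lam j)
    {j : ℕ} (hj : 1 ≤ j) (hj' : j ≤ ℓ + 1) : lam j ≤ lam 1 := by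
  induction j, hj using Nat.le_induction with
  | base => rfl
  | succ j hj ih => exact (hlam j hj (by omega)).trans (ih (by omega))

lemma entry_le_of_mem_GTwith {ℓ : ℕ} {lam : ℕ → ℕ} {r : ℕ → ℕ → ℕ}
    (hlam : ∀ j, 1 ≤ j → j ≤ ℓ → lam (j + 1) ≤ lam j) (hr : r ∈ GTwith ℓ lam)
    {i j : ℕ} (h : GTInRange ℓ i j) : r i j ≤ lam 1 := by
  obtain ⟨⟨-, h2, -⟩, h4⟩ := hr
  obtain ⟨hi, h⟩ := h
  induction i, hi using Nat.le_induction with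
  | base =>
    rw [h4 j (by omega) (by omega)]
    exact lam_le_of_le hlam (by omega) (by omega)
  | succ i hi ih =>
    exact (h2 i j (by unfold GTInRange; omega) (by unfold GTInRange; omega)).trans
      (ih (by omega))

lemma mem_lowerIndices {ℓ : ℕ} {x : Σ _ : ℕ, ℕ} :
    x ∈ lowerIndices ℓ ↔ 2 ≤ x.1 ∧ GTInRange ℓ x.1 x.2 := by
  simp only [lowerIndices, Finset.mem_sigma, Finset.mem_Icc, GTInRange]
  omega

lemma minGT_mem_GTwith {ℓ : ℕ} {lam : ℕ → ℕ}
    (hlam : ∀ j, 1 ≤ j → j ≤ ℓ → lam (j + 1) ≤ lam j) : minGT ℓ lam ∈ GTwith ℓ lam := by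
  refine ⟨⟨fun i j h => if_neg h, fun i j h h' => ?_, fun i j h h' => ?_⟩, fun j h h' => ?_⟩
  · simp only [minGT, if_pos h, if_pos h']
    unfold GTInRange at h h'
    have := hlam (i + j - 1) (by omega) (by omega)
    rwa [show i + j - 1 + 1 = i + 1 + j - 1 by omega] at this
  · simp only [minGT, if_pos h, if_pos h']
    rw [show i + (j + 1) - 1 = i + 1 + j - 1 by omega]
  · have : GTInRange ℓ 1 j := by unfold GTInRange; omega
    simp only [minGT, if_pos this, Nat.add_sub_cancel_left]

lemma psiGT_eq_psiMin_add {ℓ : ℕ} {lam : ℕ → ℕ} {r : ℕ → ℕ → ℕ} (hr : r ∈ GTwith ℓ lam) :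
    psiGT ℓ r = psiMin ℓ lam + ((∑ x, gtExcess ℓ lam r x : ℕ) : ℝ) := by
  have h1 : ∑ j ∈ Finset.Icc 1 (ℓ + 1), (r 1 j : ℝ) = ∑ j ∈ Finset.Icc 1 (ℓ + 1), (lam j : ℝ) := by
    refine Finset.sum_congr rfl fun j hj => ?_
    rw [Finset.mem_Icc] at hj
    rw [hr.2 j hj.1 hj.2]
  have h2 : ((∑ x, gtExcess ℓ lam r x : ℕ) : ℝ) =
      ∑ x ∈ lowerIndices ℓ, ((r x.1 x.2 : ℝ) - lam (x.1 + x.2 - 1)) := by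
    rw [Nat.cast_sum, ← Finset.sum_coe_sort (lowerIndices ℓ)]
    refine Finset.sum_congr rfl fun x _ => ?_
    exact Nat.cast_sub (le_entry_of_mem_GTwith hr (mem_lowerIndices.1 x.2).2)
  rw [psiGT, psiMin, h1, h2, Finset.sum_sub_distrib, lowerIndices, Finset.sum_sigma,
    Finset.sum_sigma, sum_lowerIndices ℓ fun k => (lam k : ℝ)]
  ring

lemma gtExcess_injOn (ℓ : ℕ) (lam : ℕ → ℕ) : Set.InjOn (gtExcess ℓ lam) (GTwith ℓ lam) := by
  intro r hr s hs h
  funext i j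
  by_cases hij : GTInRange ℓ i j
  · by_cases hi : 2 ≤ i
    · have h1 := congrFun h ⟨⟨i, j⟩, mem_lowerIndices.2 ⟨hi, hij⟩⟩
      have h2 := le_entry_of_mem_GTwith hr hij
      have h3 := le_entry_of_mem_GTwith hs hij
      simp only [gtExcess] at h1
      omega
    · unfold GTInRange at hij
      obtain rfl : i = 1 := by omega
      rw [hr.2 j (by omega) (by omega), hs.2 j (by omega) (by omega)]
  · rw [hr.1.1 i j hij, hs.1.1 i j hij]

lemma gtExcess_mem_piFinset {ℓ : ℕ} {lam : ℕ → ℕ} {r : ℕ → ℕ → ℕ}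
    (hlam : ∀ j, 1 ≤ j → j ≤ ℓ → lam (j + 1) ≤ lam j) (hr : r ∈ GTwith ℓ lam) :
    gtExcess ℓ lam r ∈ Fintype.piFinset fun _ => Finset.range (lam 1 + 1) := by
  refine Fintype.mem_piFinset.2 fun x => Finset.mem_range.2 ?_
  have := entry_le_of_mem_GTwith hlam hr (mem_lowerIndices.1 x.2).2
  simp only [gtExcess]
  omega

lemma finite_GTwith {ℓ : ℕ} {lam : ℕ → ℕ}
    (hlam : ∀ j, 1 ≤ j → j ≤ ℓ → lam (j + 1) ≤ lam j) : (GTwith ℓ lam).Finite :=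
  Set.Finite.of_injOn (fun _ hr => gtExcess_mem_piFinset hlam hr) (gtExcess_injOn ℓ lam)
    (Finset.finite_toSet _)

lemma rpow_two_mul_psiGT {ℓ : ℕ} {q : ℝ} (hq : 0 < q) {lam : ℕ → ℕ} {r : ℕ → ℕ → ℕ}
    (hr : r ∈ GTwith ℓ lam) :
    q ^ (2 * psiGT ℓ r) = q ^ (2 * psiMin ℓ lam) * ∏ x, (q ^ 2) ^ gtExcess ℓ lam r x := by
  rw [psiGT_eq_psiMin_add hr, mul_add, Real.rpow_add hq, Finset.prod_pow_eq_pow_sum, ← pow_mul,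
    ← Real.rpow_natCast q (2 * _), Nat.cast_mul, Nat.cast_ofNat]

/-- there is a constant `K ≥ 1` depending only on `q` and `ℓ` such
that `q^{2ψ_min(λ)} ≤ d_λ ≤ K q^{2ψ_min(λ)}` for every Young tableau `λ`
(the set of GT tableaux with top row `λ` being finite). -/
theorem stmt_8 (ℓ : ℕ) (hℓ : 1 ≤ ℓ) (q : ℝ) (hq0 : 0 < q) (hq1 : q < 1) :
    ∃ K : ℝ, 1 ≤ K ∧
      ∀ lam : ℕ → ℕ, (∀ j, 1 ≤ j → j ≤ ℓ → lam (j + 1) ≤ lam j) →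
        (GTwith ℓ lam).Finite ∧
        q ^ (2 * psiMin ℓ lam) ≤ dLam ℓ q lam ∧
        dLam ℓ q lam ≤ K * q ^ (2 * psiMin ℓ lam) := by
  have hq2 : q ^ 2 < 1 := pow_lt_one₀ hq0.le hq1 two_ne_zero
  have hq2' : 0 < q ^ 2 := by positivity
  refine ⟨(1 - q ^ 2)⁻¹ ^ Fintype.card (lowerIndices ℓ),
    one_le_pow₀ ((one_le_inv₀ (by linarith)).2 (by linarith)), fun lam hlam => ?_⟩
  have hfin := finite_GTwith hlam
  refine ⟨hfin, ?_, ?_⟩ <;> rw [dLam, finsum_mem_eq_finite_toFinset_sum _ hfin]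
  · have hmin := minGT_mem_GTwith hlam
    have hzero : ∀ x, gtExcess ℓ lam (minGT ℓ lam) x = 0 := fun x => by
      simp only [gtExcess, minGT, if_pos (mem_lowerIndices.1 x.2).2, Nat.sub_self]
    calc q ^ (2 * psiMin ℓ lam) = q ^ (2 * psiGT ℓ (minGT ℓ lam)) := by
          simp [psiGT_eq_psiMin_add hmin, hzero]
      _ ≤ _ := Finset.single_le_sum (f := fun r => q ^ (2 * psiGT ℓ r))
          (fun r _ => Real.rpow_nonneg hq0.le _) (hfin.mem_toFinset.2 hmin)
  · rw [Finset.sum_congr rfl fun r hr => rpow_two_mul_psiGT hq0 (hfin.mem_toFinset.1 hr),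
      ← Finset.mul_sum, mul_comm]
    refine mul_le_mul_of_nonneg_right ?_ (Real.rpow_nonneg hq0.le _)
    calc ∑ r ∈ hfin.toFinset, ∏ x, (q ^ 2) ^ gtExcess ℓ lam r x
        = ∑ e ∈ hfin.toFinset.image (gtExcess ℓ lam), ∏ x, (q ^ 2) ^ e x := by
          rw [Finset.sum_image]
          simpa using gtExcess_injOn ℓ lam
      _ ≤ ∑ e ∈ Fintype.piFinset fun _ : lowerIndices ℓ => Finset.range (lam 1 + 1),
            ∏ x, (q ^ 2) ^ e x := by
          refine Finset.sum_le_sum_of_subset_of_nonneg ?_ fun _ _ _ => by positivity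
          refine Finset.image_subset_iff.2 fun r hr => ?_
          exact gtExcess_mem_piFinset hlam (hfin.mem_toFinset.1 hr)
      _ = (∑ n ∈ Finset.range (lam 1 + 1), (q ^ 2) ^ n) ^ Fintype.card (lowerIndices ℓ) := by
          rw [← Finset.prod_univ_sum (fun _ => Finset.range (lam 1 + 1))
            fun _ n => (q ^ 2) ^ n, Finset.prod_const, Finset.card_univ]
      _ ≤ _ := by
          refine pow_le_pow_left₀ (by positivity) ?_ _
          rw [← tsum_geometric_of_lt_one hq2'.le hq2]
          exact (summable_geometric_of_lt_one hq2'.le hq2).sum_le_tsum _ fun _ _ => by positivity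
end

section
/- Fix an integer ℓ ≥ 1. For n, k ∈ ℕ let m_{n,k} denote the number of GT tableaux whose top row is (n+k, k, k, …, k, 0) (the vector of length ℓ+1 with first entry n+k, last entry 0, and all intermediate entries k). Then for every real p > 2ℓ+1, the series ∑_{(n,k) ∈ ℕ×ℕ, (n,k) ≠ (0,0)} m_{n,k} · (n+k)^{−p} converges. -/
/-- `m_{n,k}`: the number of GT tableaux whose top row is the length-`(ℓ+1)`
vector `(n+k, k, …, k, 0)`. -/
noncomputable def multNK (ℓ n k : ℕ) : ℕ :=
  Set.ncard {r : ℕ → ℕ → ℕ | IsGT ℓ r ∧ r 1 1 = n + k ∧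
    (∀ j, 2 ≤ j → j ≤ ℓ → r 1 j = k) ∧ r 1 (ℓ + 1) = 0}

/-- Interior entries of a GT tableau with top row `(n+k, k, …, k, 0)` all equal `k`. -/
theorem IsGT.interior_eq {ℓ k : ℕ} {r : ℕ → ℕ → ℕ} (hr : IsGT ℓ r)
    (hk : ∀ j, 2 ≤ j → j ≤ ℓ → r 1 j = k) (i j : ℕ) (hj : 2 ≤ j) (hij : i + j ≤ ℓ) :
    r (i + 1) j = k := by
  induction i generalizing j with
  | zero => exact hk j hj (by omega)
  | succ i ih =>
    have h₁ := hr.2.1 (i + 1) j (by unfold GTInRange; omega) (by unfold GTInRange; omega)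
    have h₂ := hr.2.2 (i + 1) j (by unfold GTInRange; omega) (by unfold GTInRange; omega)
    rw [ih j hj (by omega)] at h₁
    rw [ih (j + 1) (by omega) (by omega)] at h₂
    omega

/-- Columns of a GT tableau are bounded by their top entry. -/
theorem IsGT.le_top {ℓ : ℕ} {r : ℕ → ℕ → ℕ} (hr : IsGT ℓ r) (i j : ℕ)
    (hij : GTInRange ℓ (i + 1) j) : r (i + 1) j ≤ r 1 j := by
  induction i with
  | zero => exact le_rfl
  | succ i ih =>
    have hi : GTInRange ℓ (i + 1) j := by unfold GTInRange at *; omega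
    exact (hr.2.1 (i + 1) j hi hij).trans (ih hi)

/-- A GT tableau with top row `(n+k, k, …, k, 0)` is determined by the first and last entries of
the rows below the top one, so there are at most `(n+k+1)^(2ℓ-1)` of them. -/
theorem multNK_le {ℓ : ℕ} (hℓ : 1 ≤ ℓ) (n k : ℕ) : multNK ℓ n k ≤ (n + k + 1) ^ (2 * ℓ - 1) := by
  let f : (ℕ → ℕ → ℕ) → (Fin ℓ → ℕ) × (Fin (ℓ - 1) → ℕ) :=
    fun r => (fun i => r (i + 1 + 1) 1, fun i => r (i + 1 + 1) (ℓ - i))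
  let t : Finset ((Fin ℓ → ℕ) × (Fin (ℓ - 1) → ℕ)) :=
    Fintype.piFinset (fun _ => Finset.range (n + k + 1)) ×ˢ
      Fintype.piFinset (fun _ => Finset.range (n + k + 1))
  have ht : t.card = (n + k + 1) ^ (2 * ℓ - 1) := by
    simp only [t, Finset.card_product, Fintype.card_piFinset, Finset.card_range,
      Finset.prod_const, Finset.card_univ, Fintype.card_fin, ← pow_add]
    congr 1
    omega
  rw [← ht, ← Set.ncard_coe_finset, multNK]
  refine Set.ncard_le_ncard_of_injOn f ?_ ?_ t.finite_toSet
  · rintro r ⟨hr, h₁, hk, h₀⟩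
    have bound (i j : ℕ) (hij : GTInRange ℓ (i + 1) j) : r (i + 1) j < n + k + 1 := by
      have h := hr.le_top i j hij
      unfold GTInRange at hij
      rcases (by omega : j = 1 ∨ j = ℓ + 1 ∨ (2 ≤ j ∧ j ≤ ℓ)) with rfl | rfl | ⟨h2, hl⟩
      · omega
      · omega
      · have := hk j h2 hl
        omega
    simp only [f, t, Finset.coe_product, Set.mem_prod, Finset.mem_coe, Fintype.mem_piFinset,
      Finset.mem_range]
    exact ⟨fun i => bound _ _ (by unfold GTInRange; omega),
      fun i => bound _ _ (by unfold GTInRange; omega)⟩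
  · rintro r ⟨hr, hr₁, hrk, hr₀⟩ s ⟨hs, hs₁, hsk, hs₀⟩ hrs
    have hfirst (i : Fin ℓ) : r (i + 1 + 1) 1 = s (i + 1 + 1) 1 :=
      congrFun (congrArg Prod.fst hrs) i
    have hlast (i : Fin (ℓ - 1)) : r (i + 1 + 1) (ℓ - i) = s (i + 1 + 1) (ℓ - i) :=
      congrFun (congrArg Prod.snd hrs) i
    ext i j
    by_cases hij : GTInRange ℓ i j
    swap
    · rw [hr.1 i j hij, hs.1 i j hij]
    unfold GTInRange at hij
    obtain ⟨i, rfl⟩ : ∃ a, i = a + 1 := ⟨i - 1, by omega⟩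
    rcases (by omega : j = 1 ∨ (2 ≤ j ∧ i + j ≤ ℓ) ∨ (2 ≤ j ∧ i + j = ℓ + 1)) with
      rfl | ⟨h2, hl⟩ | ⟨h2, hl⟩
    · rcases i with _ | i
      · exact hr₁.trans hs₁.symm
      · exact hfirst ⟨i, by omega⟩
    · rw [hr.interior_eq hrk i j h2 hl, hs.interior_eq hsk i j h2 hl]
    · rcases i with _ | i
      · obtain rfl : j = ℓ + 1 := by omega
        exact hr₀.trans hs₀.symm
      · obtain rfl : j = ℓ - i := by omega
        exact hlast ⟨i, by omega⟩

theorem summable_mul_succ_rpow {q : ℝ} (hq : 1 < q) :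
    Summable (fun x : ℕ × ℕ => ((x.1 + 1 : ℝ)) ^ (-q) * ((x.2 + 1 : ℝ)) ^ (-q)) := by
  have h : Summable (fun n : ℕ => ((n + 1 : ℝ)) ^ (-q)) := by
    simpa using (summable_nat_add_iff 1).2 (Real.summable_nat_rpow.2 (by linarith : -q < -1))
  exact h.mul_of_nonneg h (fun n => by positivity) (fun n => by positivity)

/-- Since `(n+1)(k+1) ≤ (n+k+1)²`, a negative power of `n+k+1` is bounded by a product. -/
theorem add_add_one_rpow_neg_le {q : ℝ} (hq : 0 ≤ q) (n k : ℕ) :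
    (n + k + 1 : ℝ) ^ (-(2 * q)) ≤ (n + 1 : ℝ) ^ (-q) * (k + 1 : ℝ) ^ (-q) := by
  rw [← Real.mul_rpow (by positivity) (by positivity), ← mul_neg, Real.rpow_mul (by positivity)]
  refine Real.rpow_le_rpow_of_nonpos (by positivity) ?_ (by linarith)
  rw [Real.rpow_two]
  have hn : (0 : ℝ) ≤ n := n.cast_nonneg
  have hk : (0 : ℝ) ≤ k := k.cast_nonneg
  nlinarith [mul_nonneg hn hk]

/-- for every real `p > 2ℓ+1`, the series
`∑_{(n,k) ≠ (0,0)} m_{n,k} (n+k)^{-p}` converges. -/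
theorem stmt_14 (ℓ : ℕ) (hℓ : 1 ≤ ℓ) (p : ℝ) (hp : (2 * ℓ + 1 : ℝ) < p) :
    Summable (fun nk : ℕ × ℕ =>
      if nk = (0, 0) then (0 : ℝ)
      else (multNK ℓ nk.1 nk.2 : ℝ) * ((nk.1 + nk.2 : ℝ)) ^ (-p)) := by
  obtain ⟨q, hq⟩ : ∃ q : ℝ, 2 * q = p - (2 * ℓ - 1) := ⟨(p - (2 * ℓ - 1)) / 2, by ring⟩
  have hq1 : 1 < q := by linarith
  have hp0 : 0 < p := by linarith [(Nat.cast_nonneg ℓ : (0 : ℝ) ≤ ℓ)]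
  refine Summable.of_nonneg_of_le (fun x => ?_) (fun x => ?_)
    ((summable_mul_succ_rpow hq1).mul_left ((2 : ℝ) ^ p))
  · split_ifs <;> positivity
  obtain ⟨n, k⟩ := x
  split_ifs with h
  · positivity
  have hN : (1 : ℝ) ≤ n + k := by
    have : 1 ≤ n + k := by
      by_contra! hlt
      exact h (by ext <;> simp <;> omega)
    exact_mod_cast this
  have hpos : (0 : ℝ) < n + k + 1 := by linarith
  have hmult : (multNK ℓ n k : ℝ) ≤ (n + k + 1 : ℝ) ^ (2 * ℓ - 1 : ℝ) := by
    have hcast : (2 * ℓ - 1 : ℝ) = ((2 * ℓ - 1 : ℕ) : ℝ) := by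
      rw [Nat.cast_sub (by omega)]
      push_cast
      ring
    rw [hcast, Real.rpow_natCast]
    exact_mod_cast multNK_le hℓ n k
  have hbase : (n + k : ℝ) ^ (-p) ≤ 2 ^ p * (n + k + 1 : ℝ) ^ (-p) := by
    have := Real.rpow_le_rpow_of_nonpos (by linarith : (0 : ℝ) < (n + k + 1) / 2)
      (by linarith : ((n + k + 1) / 2 : ℝ) ≤ n + k) (by linarith : -p ≤ 0)
    rwa [Real.div_rpow hpos.le two_pos.le, Real.rpow_neg two_pos.le, div_inv_eq_mul,
      mul_comm] at this
  calc (multNK ℓ n k : ℝ) * (n + k : ℝ) ^ (-p)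
      ≤ (n + k + 1 : ℝ) ^ (2 * ℓ - 1 : ℝ) * (2 ^ p * (n + k + 1 : ℝ) ^ (-p)) := by gcongr
    _ = 2 ^ p * (n + k + 1 : ℝ) ^ (-(2 * q)) := by
      rw [mul_left_comm, ← Real.rpow_add hpos, hq]
      ring_nf
    _ ≤ 2 ^ p * ((n + 1 : ℝ) ^ (-q) * (k + 1 : ℝ) ^ (-q)) := by
      gcongr
      exact add_add_one_rpow_neg_le (by linarith) n k
end
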